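/- Let J be a finite index set, and for each j ∈ J fix a point x_j ∈ ℝ^d, a prior p_j ∈ (0,1) and a real weight a_j ∈ ℝ. Define F : ℝ^d → ℝ^d by F(x) = γ · Σ_{j ∈ J} ( P_{p_j}(x, x_j) − a_j ) · (x − x_j). Then F is differentiable, and its Fréchet derivative at any x ∈ ℝ^d is represented by the d×d matrix H(x) = γ·( Σ_{j ∈ J} ( P_{p_j}(x, x_j) − a_j ) )·I − γ² · Σ_{j ∈ J} P_{p_j}(x, x_j)·(1 − P_{p_j}(x, x_j)) · (x − x_j)(x − x_j)ᵀ, where I is the d×d identity matrix and (x − x_j)(x − x_j)ᵀ denotes the outer product. -/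

import Mathlib

/-- The half-normal density with spread parameter `σ`. -/
noncomputable def halfNormal (σ r : ℝ) : ℝ :=
  (Real.sqrt 2 / (σ * Real.sqrt Real.pi)) * Real.exp (-(r ^ 2) / (2 * σ ^ 2))

/-- The CNE link probability of two points `x y : ℝ^d` with prior `p`. -/
noncomputable def cneP (σ₁ σ₂ p : ℝ) {d : ℕ} (x y : EuclideanSpace ℝ (Fin d)) : ℝ :=
  p * halfNormal σ₁ ‖x - y‖ /
    (p * halfNormal σ₁ ‖x - y‖ + (1 - p) * halfNormal σ₂ ‖x - y‖)

theorem halfNormal_pos {σ : ℝ} (hσ : 0 < σ) (r : ℝ) : 0 < halfNormal σ r := by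
  unfold halfNormal
  positivity

theorem hasFDerivAt_halfNormal_norm_sub (σ : ℝ) {E : Type*} [NormedAddCommGroup E]
    [InnerProductSpace ℝ E] (x y : E) :
    HasFDerivAt (fun z => halfNormal σ ‖z - y‖)
      ((-(halfNormal σ ‖x - y‖ / σ ^ 2)) • innerSL ℝ (x - y)) x := by
  have h : HasFDerivAt (fun z => ‖z - y‖ ^ 2) (2 • innerSL ℝ (x - y)) x := by
    simpa using ((hasFDerivAt_id x).sub_const y).norm_sq
  have h' := (((h.const_mul (-(1 / (2 * σ ^ 2)))).exp).const_mul
    (Real.sqrt 2 / (σ * Real.sqrt Real.pi)))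
  have e : ∀ r : ℝ, -(r ^ 2) / (2 * σ ^ 2) = -(1 / (2 * σ ^ 2)) * r ^ 2 := fun r => by ring
  unfold halfNormal
  simp only [e]
  refine h'.congr_fderiv ?_
  ext v
  simp only [smul_apply, smul_eq_mul, nsmul_eq_mul]
  push_cast
  ring

theorem hasFDerivAt_cneP {σ₁ σ₂ p : ℝ} (hσ₁ : 0 < σ₁) (hσ₂ : 0 < σ₂) (hp0 : 0 < p) (hp1 : p < 1)
    {d : ℕ} (x y : EuclideanSpace ℝ (Fin d)) :
    HasFDerivAt (fun z => cneP σ₁ σ₂ p z y)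
      ((-((1 / σ₁ ^ 2 - 1 / σ₂ ^ 2) * (cneP σ₁ σ₂ p x y * (1 - cneP σ₁ σ₂ p x y)))) •
        innerSL ℝ (x - y)) x := by
  have hA := (hasFDerivAt_halfNormal_norm_sub σ₁ x y).const_mul p
  have hB := (hasFDerivAt_halfNormal_norm_sub σ₂ x y).const_mul (1 - p)
  have hA0 := halfNormal_pos hσ₁ ‖x - y‖
  have hB0 := halfNormal_pos hσ₂ ‖x - y‖
  have hp : 0 < 1 - p := sub_pos.2 hp1
  have hne : p * halfNormal σ₁ ‖x - y‖ + (1 - p) * halfNormal σ₂ ‖x - y‖ ≠ 0 := by positivity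
  unfold cneP
  simp only [div_eq_mul_inv]
  refine (hA.fun_mul ((hasDerivAt_inv hne).comp_hasFDerivAt x (hA.fun_add hB))).congr_fderiv ?_
  ext v
  simp only [Function.comp_apply, smul_apply, add_apply, smul_eq_mul]
  field_simp
  ring

theorem toEuclideanCLM_vecMulVec_apply {n : Type*} [Fintype n] [DecidableEq n]
    (u w v : EuclideanSpace ℝ n) :
    Matrix.toEuclideanCLM (𝕜 := ℝ) (Matrix.vecMulVec (fun i => u i) (fun i => w i)) v =
      inner ℝ w v • u := by
  ext i
  simp [Matrix.vecMulVec, Matrix.mulVec, dotProduct, PiLp.inner_apply, Finset.sum_mul]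
  exact Finset.sum_congr rfl fun j _ => by ring

/-- The CNE gradient map `F(x) = γ · Σ_j (P_{p_j}(x, x_j) − a_j) · (x − x_j)` is differentiable,
and its Fréchet derivative at `x` is represented by the matrix
`H(x) = γ·(Σ_j (P_{p_j}(x,x_j) − a_j))·I − γ²·Σ_j P_{p_j}(x,x_j)(1 − P_{p_j}(x,x_j))·(x−x_j)(x−x_j)ᵀ`. -/
theorem cne_hessian (d : ℕ) (hd : 1 ≤ d)
    (σ₁ σ₂ : ℝ) (hσ₁ : 0 < σ₁) (hσ₁₂ : σ₁ < σ₂)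
    (γ : ℝ) (hγ : γ = 1 / σ₁ ^ 2 - 1 / σ₂ ^ 2)
    (J : Type*) [Fintype J]
    (xs : J → EuclideanSpace ℝ (Fin d)) (p : J → ℝ)
    (hp0 : ∀ j, 0 < p j) (hp1 : ∀ j, p j < 1) (a : J → ℝ)
    (F : EuclideanSpace ℝ (Fin d) → EuclideanSpace ℝ (Fin d))
    (hF : F = fun x => γ • ∑ j : J, (cneP σ₁ σ₂ (p j) x (xs j) - a j) • (x - xs j))
    (H : EuclideanSpace ℝ (Fin d) → Matrix (Fin d) (Fin d) ℝ)
    (hH : H = fun x =>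
      γ • ((∑ j : J, (cneP σ₁ σ₂ (p j) x (xs j) - a j)) • (1 : Matrix (Fin d) (Fin d) ℝ))
        - γ ^ 2 • ∑ j : J,
            (cneP σ₁ σ₂ (p j) x (xs j) * (1 - cneP σ₁ σ₂ (p j) x (xs j))) •
              Matrix.vecMulVec (fun i => (x - xs j) i) (fun i => (x - xs j) i)) :
    Differentiable ℝ F ∧
    ∀ x : EuclideanSpace ℝ (Fin d),
      fderiv ℝ F x = Matrix.toEuclideanCLM (𝕜 := ℝ) (H x) := by
  have key : ∀ x, HasFDerivAt F (Matrix.toEuclideanCLM (𝕜 := ℝ) (H x)) x := by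
    intro x
    have h := (HasFDerivAt.fun_sum (u := Finset.univ) fun j _ =>
      ((hasFDerivAt_cneP hσ₁ (hσ₁.trans hσ₁₂) (hp0 j) (hp1 j) x (xs j)).sub_const (a j)).fun_smul
        ((hasFDerivAt_id x).sub_const (xs j))).const_smul γ
    subst hF hH
    refine h.congr_fderiv ?_
    ext1 v
    simp only [← hγ, map_sub, map_smul, map_sum, map_one, id_eq, smul_apply, sub_apply, add_apply,
      sum_apply, one_apply_eq_self, ContinuousLinearMap.smulRight_apply,
      ContinuousLinearMap.id_apply, toEuclideanCLM_vecMulVec_apply, innerSL_apply_apply]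
    rw [Finset.sum_add_distrib, smul_add, ← Finset.sum_smul, sub_eq_add_neg, ← smul_neg,
      ← Finset.sum_neg_distrib, Finset.smul_sum, Finset.smul_sum]
    congr 1
    refine Finset.sum_congr rfl fun j _ => ?_
    rw [inner_sub_left]
    module
  exact ⟨fun x => (key x).differentiableAt, fun x => (key x).fderiv⟩
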